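/- For every k ≥ 4, extension preservation fails on the class Clique_k of all finite simple graphs of cliquewidth at most k: there exists a first-order sentence in the language of graphs that is preserved by embeddings over Clique_k but is not equivalent over Clique_k to any existential sentence. -/

import Mathlib

open FirstOrder Language

/-- Satisfaction of a first-order sentence in the language of graphs by a simple graph. -/
def GSat {V : Type} (G : SimpleGraph V) (φ : Language.graph.Sentence) : Prop :=
  @Sentence.Realize Language.graph V G.structure φ

/-- A sentence is existential if it has the form `∃ x₁ … xₙ θ` with `θ` quantifier-free. -/
def IsExistentialSentence {L : Language} (ψ : L.Sentence) : Prop :=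
  ∃ (n : ℕ) (θ : L.BoundedFormula Empty n), θ.IsQF ∧ ψ = θ.exs

/-- `CliqueExpr k V G c` means the `k`-colored graph `(G, c)` is constructible using the
cliquewidth operations: creating a single colored vertex, disjoint union, adding all edges
between two distinct color classes, and recoloring. -/
inductive CliqueExpr (k : ℕ) : (V : Type) → SimpleGraph V → (V → Fin k) → Prop
  | single (c : Fin k) : CliqueExpr k PUnit ⊥ (fun _ => c)
  | union {V W : Type} {G : SimpleGraph V} {H : SimpleGraph W} {cG : V → Fin k} {cH : W → Fin k} :
      CliqueExpr k V G cG → CliqueExpr k W H cH →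
      CliqueExpr k (V ⊕ W) (G ⊕g H) (Sum.elim cG cH)
  | addEdges {V : Type} {G : SimpleGraph V} {c : V → Fin k} (i j : Fin k) (hij : i ≠ j) :
      CliqueExpr k V G c →
      CliqueExpr k V (G ⊔ SimpleGraph.fromRel (fun x y => c x = i ∧ c y = j)) c
  | recolor {V : Type} {G : SimpleGraph V} {c : V → Fin k} (i j : Fin k) :
      CliqueExpr k V G c → CliqueExpr k V G (fun v => if c v = i then j else c v)

/-- `G` has cliquewidth at most `k`: it is isomorphic to the underlying graph of a
constructible `k`-colored graph. -/
def CliquewidthLE {V : Type} (G : SimpleGraph V) (k : ℕ) : Prop :=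
  ∃ (W : Type) (H : SimpleGraph W) (c : W → Fin k), CliqueExpr k W H c ∧ Nonempty (G ≃g H)

/-! ### First-order formulas over graphs -/

/-- Satisfaction of a first-order formula in the language of graphs under an assignment. -/
def GHolds {V γ : Type} (G : SimpleGraph V) (φ : Language.graph.Formula γ) (v : γ → V) : Prop :=
  @Formula.Realize Language.graph V G.structure γ φ v

namespace GHolds

variable {V γ : Type} {G : SimpleGraph V} {v : γ → V} {φ ψ : Language.graph.Formula γ}

/-- The formula expressing that two variables are adjacent. -/
def adjF (x y : γ) : Language.graph.Formula γ :=
  Language.adj.formula₂ (Term.var x) (Term.var y)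

/-- The formula expressing that two variables are equal. -/
def eqF (x y : γ) : Language.graph.Formula γ :=
  Term.equal (Term.var x) (Term.var y)

lemma adjF_iff {x y : γ} : GHolds G (adjF x y) v ↔ G.Adj (v x) (v y) := by
  let := G.structure
  exact Formula.realize_rel₂

lemma eqF_iff {x y : γ} : GHolds G (eqF x y) v ↔ v x = v y := by
  let := G.structure
  exact Formula.realize_equal

lemma neg_iff : GHolds G φ.not v ↔ ¬ GHolds G φ v := Iff.rfl

lemma inf_iff : GHolds G (φ ⊓ ψ) v ↔ GHolds G φ v ∧ GHolds G ψ v := by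
  let := G.structure
  exact Formula.realize_inf

lemma sup_iff : GHolds G (φ ⊔ ψ) v ↔ GHolds G φ v ∨ GHolds G ψ v := by
  let := G.structure
  exact Formula.realize_sup

lemma imp_iff : GHolds G (φ.imp ψ) v ↔ (GHolds G φ v → GHolds G ψ v) := by
  let := G.structure
  exact Formula.realize_imp

lemma iExs_iff {δ : Type} [Finite δ] {φ : Language.graph.Formula (γ ⊕ δ)} :
    GHolds G (φ.iExs δ) v ↔ ∃ w : δ → V, GHolds G φ (Sum.elim v w) := by
  let := G.structure
  exact Formula.realize_iExs

lemma iAlls_iff {δ : Type} [Finite δ] {φ : Language.graph.Formula (γ ⊕ δ)} :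
    GHolds G (φ.iAlls δ) v ↔ ∀ w : δ → V, GHolds G φ (Sum.elim v w) := by
  let := G.structure
  exact Formula.realize_iAlls

end GHolds

/-- An existential sentence true in `H` is already true in every induced subgraph of `H`
containing suitable finitely many vertices. -/
lemma IsExistentialSentence.exists_witnesses {ψ : Language.graph.Sentence}
    (hψ : IsExistentialSentence ψ) :
    ∃ n : ℕ, ∀ (V : Type) (H : SimpleGraph V), GSat H ψ → ∃ x : Fin n → V,
      ∀ (U : Type) (G : SimpleGraph U) (f : G ↪g H), (∀ i, ∃ u, f u = x i) → GSat G ψ := by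
  obtain ⟨n, θ, hθ, rfl⟩ := hψ
  refine ⟨n, fun V H hH => ?_⟩
  let := H.structure
  obtain ⟨x, hx⟩ := BoundedFormula.realize_exs.1 hH
  refine ⟨x, fun U G f hf => ?_⟩
  choose u hu using hf
  let := G.structure
  let F : U ↪[Language.graph] V :=
    { toFun := f
      inj' := f.injective
      map_fun' := fun g => isEmptyElim g
      map_rel' := by
        rintro _ ⟨⟩ y
        exact f.map_adj_iff }
  refine BoundedFormula.realize_exs.2 ⟨u, (hθ.realize_embedding F).1 ?_⟩
  convert hx using 1
  exact funext hu

/-! ### The sentence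

The eleven parameters `e 0, …, e 10` are two `4`-cliques `e 0, …, e 3` and `e 4, …, e 7`, followed
by three vertices: the first two and the last vertex of a path. -/

section Configurations

variable {V W : Type} (G : SimpleGraph V) (e : Fin 11 → V)

/-- The interior vertices of the path. -/
def IsInner (x : V) : Prop :=
  G.Adj x (e 4) ∧ ¬ G.Adj x (e 0) ∧ ¬ G.Adj x (e 5) ∧ x ≠ e 5

/-- The vertices whose neighbourhoods are the cuts ordering the path. -/
def IsCut (b : V) : Prop :=
  ¬ G.Adj b (e 4) ∧ G.Adj b (e 8)

/-- Four pairwise adjacent vertices. -/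
def IsFourClique (x y z w : V) : Prop :=
  G.Adj x y ∧ G.Adj x z ∧ G.Adj x w ∧ G.Adj y z ∧ G.Adj y w ∧ G.Adj z w

/-- The quantifier-free condition on the parameters. -/
def IsFrame : Prop :=
  IsFourClique G (e 0) (e 1) (e 2) (e 3) ∧ IsFourClique G (e 4) (e 5) (e 6) (e 7) ∧
  e 0 ≠ e 4 ∧ ¬ G.Adj (e 0) (e 4) ∧ G.Adj (e 8) (e 0) ∧ G.Adj (e 8) (e 4) ∧
  G.Adj (e 8) (e 9) ∧ IsInner G e (e 9) ∧ ¬ G.Adj (e 10) (e 4) ∧ ¬ G.Adj (e 10) (e 8)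

/-- Two cuts order two interior vertices in opposite ways. -/
def HasCrossing : Prop :=
  ∃ w : Fin 4 → V, IsInner G e (w 0) ∧ IsInner G e (w 1) ∧ IsCut G e (w 2) ∧ IsCut G e (w 3) ∧
    G.Adj (w 2) (w 0) ∧ ¬ G.Adj (w 2) (w 1) ∧ G.Adj (w 3) (w 1) ∧ ¬ G.Adj (w 3) (w 0)

/-- In a path `w 0, w 1, w 2`, some interior vertex `w 3 ≠ w 1` lies strictly between `w 0` and
`w 2`, as shown by the cuts `w 4` and `w 5`. -/
def HasTwin : Prop :=
  ∃ w : Fin 6 → V, (IsInner G e (w 0) ∨ w 0 = e 8) ∧ IsInner G e (w 1) ∧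
    (IsInner G e (w 2) ∨ w 2 = e 10) ∧ IsInner G e (w 3) ∧ IsCut G e (w 4) ∧ IsCut G e (w 5) ∧
    G.Adj (w 0) (w 1) ∧ G.Adj (w 1) (w 2) ∧ G.Adj (w 4) (w 0) ∧ ¬ G.Adj (w 4) (w 3) ∧
    G.Adj (w 5) (w 3) ∧ ¬ G.Adj (w 5) (w 2) ∧ w 3 ≠ w 1

/-- Every interior vertex has a neighbour further along the path. -/
def Climbs : Prop :=
  ∀ x : Fin 1 → V, IsInner G e (x 0) → ∃ w : Fin 2 → V, (IsInner G e (w 0) ∨ w 0 = e 10) ∧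
    IsCut G e (w 1) ∧ G.Adj (x 0) (w 0) ∧ G.Adj (w 1) (x 0) ∧ ¬ G.Adj (w 1) (w 0)

/-- The property separating first-order preservation from existential definability. -/
def HasFullPath : Prop :=
  ∃ e : Fin 11 → V, IsFrame G e ∧ (HasCrossing G e ∨ HasTwin G e ∨ Climbs G e)

end Configurations

open GHolds in
/-- `HasFullPath` is first-order definable. -/
lemma exists_sentence_hasFullPath :
    ∃ φ : Language.graph.Sentence, ∀ (V : Type) (G : SimpleGraph V),
      GSat G φ ↔ HasFullPath G := by
  let inner {γ : Type} (p : Fin 11 → γ) (x : γ) : Language.graph.Formula γ :=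
    adjF x (p 4) ⊓ ((adjF x (p 0)).not ⊓ ((adjF x (p 5)).not ⊓ (eqF x (p 5)).not))
  let cut {γ : Type} (p : Fin 11 → γ) (b : γ) : Language.graph.Formula γ :=
    (adjF b (p 4)).not ⊓ adjF b (p 8)
  let clique {γ : Type} (x y z w : γ) : Language.graph.Formula γ :=
    adjF x y ⊓ (adjF x z ⊓ (adjF x w ⊓ (adjF y z ⊓ (adjF y w ⊓ adjF z w))))
  have inner_iff {V γ : Type} (G : SimpleGraph V) (v : γ → V) (p : Fin 11 → γ) (x : γ) :
      GHolds G (inner p x) v ↔ IsInner G (v ∘ p) (v x) := by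
    simp only [inner, IsInner, inf_iff, neg_iff, adjF_iff, eqF_iff, Function.comp_apply, ne_eq]
  have cut_iff {V γ : Type} (G : SimpleGraph V) (v : γ → V) (p : Fin 11 → γ) (x : γ) :
      GHolds G (cut p x) v ↔ IsCut G (v ∘ p) (v x) := by
    simp only [cut, IsCut, inf_iff, neg_iff, adjF_iff, Function.comp_apply]
  have clique_iff {V γ : Type} (G : SimpleGraph V) (v : γ → V) (x y z w : γ) :
      GHolds G (clique x y z w) v ↔ IsFourClique G (v x) (v y) (v z) (v w) := by
    simp only [clique, IsFourClique, inf_iff, adjF_iff]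
  let p : Fin 11 → Empty ⊕ Fin 11 := Sum.inr
  let frame : Language.graph.Formula (Empty ⊕ Fin 11) :=
    clique (p 0) (p 1) (p 2) (p 3) ⊓ (clique (p 4) (p 5) (p 6) (p 7) ⊓
      ((eqF (p 0) (p 4)).not ⊓ ((adjF (p 0) (p 4)).not ⊓ (adjF (p 8) (p 0) ⊓ (adjF (p 8) (p 4) ⊓
      (adjF (p 8) (p 9) ⊓ (inner p (p 9) ⊓
      ((adjF (p 10) (p 4)).not ⊓ (adjF (p 10) (p 8)).not))))))))
  let l {γ : Type} (δ : Type) (p : Fin 11 → γ) : Fin 11 → γ ⊕ δ := Sum.inl ∘ p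
  let crossing : Language.graph.Formula ((Empty ⊕ Fin 11) ⊕ Fin 4) :=
    let p := l (Fin 4) p
    let w : Fin 4 → (Empty ⊕ Fin 11) ⊕ Fin 4 := Sum.inr
    inner p (w 0) ⊓ (inner p (w 1) ⊓ (cut p (w 2) ⊓ (cut p (w 3) ⊓ (adjF (w 2) (w 0) ⊓
      ((adjF (w 2) (w 1)).not ⊓ (adjF (w 3) (w 1) ⊓ (adjF (w 3) (w 0)).not))))))
  let twin : Language.graph.Formula ((Empty ⊕ Fin 11) ⊕ Fin 6) :=
    let p := l (Fin 6) p
    let w : Fin 6 → (Empty ⊕ Fin 11) ⊕ Fin 6 := Sum.inr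
    (inner p (w 0) ⊔ eqF (w 0) (p 8)) ⊓ (inner p (w 1) ⊓ ((inner p (w 2) ⊔ eqF (w 2) (p 10)) ⊓
      (inner p (w 3) ⊓ (cut p (w 4) ⊓ (cut p (w 5) ⊓ (adjF (w 0) (w 1) ⊓ (adjF (w 1) (w 2) ⊓
      (adjF (w 4) (w 0) ⊓ ((adjF (w 4) (w 3)).not ⊓ (adjF (w 5) (w 3) ⊓
      ((adjF (w 5) (w 2)).not ⊓ (eqF (w 3) (w 1)).not)))))))))))
  let up : Language.graph.Formula (((Empty ⊕ Fin 11) ⊕ Fin 1) ⊕ Fin 2) :=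
    let p := l (Fin 2) (l (Fin 1) p)
    let x : ((Empty ⊕ Fin 11) ⊕ Fin 1) ⊕ Fin 2 := Sum.inl (Sum.inr 0)
    let w : Fin 2 → ((Empty ⊕ Fin 11) ⊕ Fin 1) ⊕ Fin 2 := Sum.inr
    (inner p (w 0) ⊔ eqF (w 0) (p 10)) ⊓ (cut p (w 1) ⊓ (adjF x (w 0) ⊓
      (adjF (w 1) x ⊓ (adjF (w 1) (w 0)).not)))
  refine ⟨(frame ⊓ (crossing.iExs (Fin 4) ⊔ (twin.iExs (Fin 6) ⊔
    ((inner (l (Fin 1) p) (Sum.inr 0)).imp (up.iExs (Fin 2))).iAlls (Fin 1)))).iExs (Fin 11),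
    fun V G => ?_⟩
  refine (iExs_iff (v := default)).trans (exists_congr fun e => ?_)
  simp only [inf_iff, sup_iff, iExs_iff, iAlls_iff, imp_iff, neg_iff, adjF_iff, eqF_iff, inner_iff,
    cut_iff, clique_iff, frame, crossing, twin, up, IsFrame, HasCrossing, HasTwin, Climbs, p, l,
    ← Function.comp_assoc, Sum.elim_comp_inl, Sum.elim_comp_inr, Sum.elim_inl, Sum.elim_inr,
    Function.comp_apply, ne_eq]

/-! ### Preservation under embeddings -/

section Embeddings

variable {V W : Type} {G : SimpleGraph V} {H : SimpleGraph W} {e : Fin 11 → V}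

lemma isInner_map_iff (f : G ↪g H) {x : V} : IsInner H (f ∘ e) (f x) ↔ IsInner G e x := by
  simp [IsInner]

lemma isCut_map_iff (f : G ↪g H) {b : V} : IsCut H (f ∘ e) (f b) ↔ IsCut G e b := by
  simp [IsCut]

lemma isFrame_map_iff (f : G ↪g H) : IsFrame H (f ∘ e) ↔ IsFrame G e := by
  simp [IsFrame, IsFourClique, isInner_map_iff]

lemma HasCrossing.map (h : HasCrossing G e) (f : G ↪g H) : HasCrossing H (f ∘ e) := by
  obtain ⟨w, h⟩ := h
  exact ⟨f ∘ w, by simpa [isInner_map_iff, isCut_map_iff] using h⟩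

lemma HasTwin.map (h : HasTwin G e) (f : G ↪g H) : HasTwin H (f ∘ e) := by
  obtain ⟨w, h⟩ := h
  exact ⟨f ∘ w, by simpa [isInner_map_iff, isCut_map_iff] using h⟩

/-- If `G` has a full path and the frame has no defect in `H`, then every interior vertex of `H`
comes from `G`. -/
lemma Climbs.exists_eq_of_isInner [Finite V] (hG : Climbs G e) (f : G ↪g H) (hF : IsFrame G e)
    (hC : ¬ HasCrossing H (f ∘ e)) (hT : ¬ HasTwin H (f ∘ e)) {w : W}
    (hw : IsInner H (f ∘ e) w) : ∃ x, f x = w := by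
  by_contra! hne
  have hC' : ¬ HasCrossing G e := fun h => hC (h.map f)
  obtain ⟨-, -, -, h04, h80, h84, h89, h9, h10, -⟩ := hF
  have key : ∀ (n : ℕ) (x y b : V), Set.ncard {b | IsCut G e b ∧ G.Adj b y} = n →
      (IsInner G e x ∨ x = e 8) → IsInner G e y → G.Adj x y → IsCut G e b → G.Adj b x →
      ¬ H.Adj (f b) w → False := by
    intro n
    induction n using Nat.strong_induction_on with
    | _ n ih =>
      intro x y b hn hx hy hxy hb hbx hbw
      have noTwin : ∀ z b', (IsInner G e z ∨ z = e 10) → IsCut G e b' → G.Adj y z →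
          ¬ G.Adj b' z → ¬ H.Adj (f b') w := by
        intro z b' hz hb' hyz hbz hbw'
        refine hT ⟨![f x, f y, f z, w, f b, f b'], ?_⟩
        simpa [isInner_map_iff, isCut_map_iff, hx, hy, hz, hw, hb, hb', hxy, hyz, hbx, hbw, hbw',
          hbz] using (hne y).symm
      obtain ⟨v, hz, hb', hyz, hby, hbz⟩ := hG ![y] hy
      generalize v 0 = z at *
      generalize v 1 = b' at *
      have hbw' := noTwin z b' hz hb' hyz hbz
      rcases hz with hz | rfl
      · refine ih _ ?_ y z b' rfl (Or.inl hy) hz hyz hb' hby hbw'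
        rw [← hn]
        refine Set.ncard_lt_ncard ⟨fun c hc => ⟨hc.1, ?_⟩, fun h => hbz (h ⟨hb', hby⟩).2⟩
          (Set.toFinite _)
        by_contra hcy
        exact hC' ⟨![y, z, b', c], hy, hz, hb', hc.1, hby, hbz, hc.2, hcy⟩
      · exact noTwin (e 10) (e 4) (Or.inr rfl) ⟨G.irrefl, h84.symm⟩ hyz
          (fun h => h10 h.symm) hw.1.symm
  exact key _ (e 8) (e 9) (e 0) rfl (Or.inr rfl) h9 h89 ⟨h04, h80.symm⟩ h80.symm
    fun h => hw.2.1 h.symm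

/-- `HasFullPath` is preserved by embeddings. -/
lemma HasFullPath.map [Finite V] (h : HasFullPath G) (f : G ↪g H) : HasFullPath H := by
  obtain ⟨e, hF, h⟩ := h
  refine ⟨f ∘ e, (isFrame_map_iff f).2 hF, ?_⟩
  by_cases hC : HasCrossing H (f ∘ e)
  · exact Or.inl hC
  by_cases hT : HasTwin H (f ∘ e)
  · exact Or.inr (Or.inl hT)
  rcases h with h | h | h
  · exact Or.inl (h.map f)
  · exact Or.inr (Or.inl (h.map f))
  refine Or.inr (Or.inr fun x hx => ?_)
  obtain ⟨u, hu⟩ := h.exists_eq_of_isInner f hF hC hT hx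
  rw [← hu] at hx ⊢
  obtain ⟨w, hw⟩ := h ![u] ((isInner_map_iff f).1 hx)
  exact ⟨f ∘ w, by simpa [isInner_map_iff, isCut_map_iff] using hw⟩

end Embeddings

/-! ### The path with a half graph -/

/-- Path vertices `a i`, cuts `b j`, and two triples `g s 0, g s 1, g s 2`. -/
inductive LadderVertex
  | a (i : ℕ)
  | b (j : ℕ)
  | g (s : Bool) (k : Fin 3)
  deriving DecidableEq

namespace LadderVertex

/-- The index of the cut completing the triple on side `s` to a `4`-clique. -/
def root (N : ℕ) (s : Bool) : ℕ := if s then N else 0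

/-- Adjacency in the ladder. -/
def LadderAdj (N : ℕ) : LadderVertex → LadderVertex → Prop
  | a i, a j => i = j + 1 ∨ j = i + 1
  | a i, b j => i ≤ j
  | b j, a i => i ≤ j
  | b j, g s _ => j = root N s
  | g s _, b j => j = root N s
  | g s k, g s' k' => s = s' ∧ k ≠ k'
  | _, _ => False

/-- The path `a 0, a 1, …` together with cuts `b j` adjacent to `a 0, …, a j`, where the cuts
`b 0` and `b N` lie in `4`-cliques. -/
def ladder (N : ℕ) : SimpleGraph LadderVertex where
  Adj := LadderAdj N
  symm := ⟨by rintro (_ | _ | _) (_ | _ | _) <;> simp [LadderAdj] <;> grind⟩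
  loopless := ⟨by rintro (_ | _ | _) <;> simp [LadderAdj]⟩

variable {N : ℕ}

@[simp] lemma adj_a_a {i j : ℕ} : (ladder N).Adj (a i) (a j) ↔ i = j + 1 ∨ j = i + 1 := Iff.rfl
@[simp] lemma adj_a_b {i j : ℕ} : (ladder N).Adj (a i) (b j) ↔ i ≤ j := Iff.rfl
@[simp] lemma adj_b_a {i j : ℕ} : (ladder N).Adj (b j) (a i) ↔ i ≤ j := Iff.rfl
@[simp] lemma adj_b_b {i j : ℕ} : ¬ (ladder N).Adj (b i) (b j) := id
@[simp] lemma adj_a_g {i : ℕ} {s k} : ¬ (ladder N).Adj (a i) (g s k) := id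
@[simp] lemma adj_g_a {i : ℕ} {s k} : ¬ (ladder N).Adj (g s k) (a i) := id
@[simp] lemma adj_b_g {j : ℕ} {s k} : (ladder N).Adj (b j) (g s k) ↔ j = root N s := Iff.rfl
@[simp] lemma adj_g_b {j : ℕ} {s k} : (ladder N).Adj (g s k) (b j) ↔ j = root N s := Iff.rfl
@[simp] lemma adj_g_g {s k s' k'} :
    (ladder N).Adj (g s k) (g s' k') ↔ s = s' ∧ k ≠ k' := Iff.rfl
@[simp] lemma root_true : root N true = N := rfl
@[simp] lemma root_false : root N false = 0 := rfl

lemma fourClique_cases {x y z w : LadderVertex} (h : IsFourClique (ladder N) x y z w) :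
    (∃ s, x = b (root N s)) ∨ ∃ s k, x = g s k := by
  obtain ⟨h1, h2, h3, h4, h5, h6⟩ := h
  rcases x with i | i | ⟨s, k⟩
  · exfalso
    rcases y with _ | _ | _ <;> rcases z with _ | _ | _ <;> rcases w with _ | _ | _ <;>
      simp at * <;> omega
  · rcases y with _ | _ | _ <;> rcases z with _ | _ | _ <;> rcases w with _ | _ | _ <;>
      simp at * <;> grind [root]
  · exact Or.inr ⟨s, k, rfl⟩

/-- In a ladder, a frame sits in the intended place. -/
lemma frame_cases {e : Fin 11 → LadderVertex} (hN : 1 ≤ N) (h : IsFrame (ladder N) e) :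
    e 0 = b 0 ∧ e 4 = b N ∧ (∃ k, e 5 = g true k) ∧ e 8 = a 0 ∧ ¬ (ladder N).Adj (e 10) (e 4) ∧
      ¬ (ladder N).Adj (e 10) (e 8) := by
  obtain ⟨hp, hq, hne, hpq, hsp, hsq, hsr, ⟨hrq, hrp, hrq1, hrq1'⟩, htq, hts⟩ := h
  have hq1 : IsFourClique (ladder N) (e 5) (e 4) (e 6) (e 7) := by
    obtain ⟨h1, h2, h3, h4, h5, h6⟩ := hq
    exact ⟨h1.symm, h4, h5, h2, h3, h6⟩
  have hqq := hq.1
  replace hp := fourClique_cases hp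
  replace hq := fourClique_cases hq
  replace hq1 := fourClique_cases hq1
  refine (?_ : _ ∧ _ ∧ _ ∧ _).imp id fun h => ⟨h.1, h.2.1, h.2.2, htq, hts⟩
  generalize e 0 = p at *
  generalize e 4 = q at *
  generalize e 5 = q1 at *
  generalize e 8 = s at *
  generalize e 9 = r at *
  clear htq hts
  rcases hp with ⟨sp, rfl⟩ | ⟨sp, kp, rfl⟩ <;> rcases hq with ⟨sq, rfl⟩ | ⟨sq, kq, rfl⟩ <;>
    rcases s with i | j | ⟨s, k⟩ <;> rcases hq1 with ⟨sq1, rfl⟩ | ⟨sq1, kq1, rfl⟩ <;>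
    rcases r with i' | j' | ⟨s', k'⟩ <;> cases sp <;> cases sq <;> simp at * <;> grind [root]

lemma isInner_iff {e : Fin 11 → LadderVertex} (hN : 1 ≤ N) (h : IsFrame (ladder N) e)
    {x : LadderVertex} : IsInner (ladder N) e x ↔ ∃ i, x = a i ∧ 1 ≤ i ∧ i ≤ N := by
  obtain ⟨h0, h4, ⟨k, h5⟩, -, -, -⟩ := frame_cases hN h
  rw [IsInner, h0, h4, h5]
  rcases x with i | j | ⟨s, k'⟩
  · simp; omega
  · simp
  · cases s <;> simp

lemma isCut_iff {e : Fin 11 → LadderVertex} (hN : 1 ≤ N) (h : IsFrame (ladder N) e)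
    {x : LadderVertex} : IsCut (ladder N) e x ↔ ∃ j, x = b j := by
  obtain ⟨-, h4, -, h8, -, -⟩ := frame_cases hN h
  rw [IsCut, h4, h8]
  rcases x with i | j | ⟨s, k⟩ <;> simp
  omega

/-- A neighbour of an interior vertex that is interior or the last path vertex lies on the path. -/
lemma eq_a_of_adj {e : Fin 11 → LadderVertex} (hN : 1 ≤ N) (h : IsFrame (ladder N) e) {i : ℕ}
    {x : LadderVertex} (hx : IsInner (ladder N) e x ∨ x = e 10) (hi : (ladder N).Adj (a i) x) :
    ∃ j, x = a j ∧ 1 ≤ j := by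
  rcases hx with hx | hx
  · obtain ⟨j, rfl, hj, -⟩ := (isInner_iff hN h).1 hx
    exact ⟨j, rfl, hj⟩
  · obtain ⟨-, h4, -, h8, h10, h10'⟩ := frame_cases hN h
    rw [← hx, h4] at h10
    rw [← hx, h8] at h10'
    rcases x with j | j | ⟨s, k⟩
    · simp at h10
      exact ⟨j, rfl, by omega⟩
    · simp at h10'
    · simp at hi

lemma not_hasCrossing {e : Fin 11 → LadderVertex} (hN : 1 ≤ N) (h : IsFrame (ladder N) e) :
    ¬ HasCrossing (ladder N) e := by
  rintro ⟨w, h0, h1, h2, h3, h⟩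
  rw [isInner_iff hN ‹_›] at h0 h1
  rw [isCut_iff hN ‹_›] at h2 h3
  obtain ⟨i0, e0, -⟩ := h0
  obtain ⟨i1, e1, -⟩ := h1
  obtain ⟨i2, e2⟩ := h2
  obtain ⟨i3, e3⟩ := h3
  simp [e0, e1, e2, e3] at h
  omega

lemma not_hasTwin {e : Fin 11 → LadderVertex} (hN : 1 ≤ N) (h : IsFrame (ladder N) e) :
    ¬ HasTwin (ladder N) e := by
  rintro ⟨w, h0, h1, h2, h3, h4, h5, h6, h7, h8⟩
  have h0' : ∃ i, w 0 = a i := by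
    rcases h0 with h0 | h0
    · obtain ⟨i, hi, -⟩ := (isInner_iff hN h).1 h0
      exact ⟨i, hi⟩
    · exact ⟨0, h0.trans (frame_cases hN h).2.2.2.1⟩
  rw [isInner_iff hN h] at h1 h3
  rw [isCut_iff hN h] at h4 h5
  obtain ⟨i0, e0⟩ := h0'
  obtain ⟨i1, e1, -⟩ := h1
  rw [e1] at h7
  obtain ⟨i2, e2, -⟩ := eq_a_of_adj hN h h2 h7
  obtain ⟨i3, e3, -⟩ := h3
  obtain ⟨i4, e4⟩ := h4
  obtain ⟨i5, e5⟩ := h5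
  simp [e0, e1, e2, e3, e4, e5] at h6 h7 h8
  omega

/-- The vertices of a ladder constructed in the first `m` rounds, without `a d`. -/
def stage (N d m : ℕ) : Set LadderVertex
  | a i => i ≤ m ∧ i ≠ d
  | b j => j < m
  | g s _ => root N s < m

@[simp] lemma a_mem_stage {d m i : ℕ} : a i ∈ stage N d m ↔ i ≤ m ∧ i ≠ d := Iff.rfl
@[simp] lemma b_mem_stage {d m j : ℕ} : b j ∈ stage N d m ↔ j < m := Iff.rfl
@[simp] lemma g_mem_stage {d m : ℕ} {s k} : g s k ∈ stage N d m ↔ root N s < m := Iff.rfl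

/-- The complete ladder has a full path. -/
lemma hasFullPath_ladder {d : ℕ} (hN : 1 ≤ N) (hd : N + 2 ≤ d) :
    HasFullPath ((ladder N).induce (stage N d (N + 1))) := by
  let f := SimpleGraph.Embedding.induce (G := ladder N) (stage N d (N + 1))
  have hroot : ∀ s, root N s < N + 1 := by simp
  let P (i : ℕ) (hi : i ≤ N + 1) : stage N d (N + 1) := ⟨a i, hi, by omega⟩
  let B (j : ℕ) (hj : j < N + 1) : stage N d (N + 1) := ⟨b j, hj⟩
  let T (s : Bool) (k : Fin 3) : stage N d (N + 1) := ⟨g s k, hroot s⟩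
  let e : Fin 11 → stage N d (N + 1) :=
    ![B 0 (by omega), T false 0, T false 1, T false 2, B N (by omega), T true 0, T true 1, T true 2,
      P 0 (by omega), P 1 (by omega), P (N + 1) le_rfl]
  have hF : IsFrame ((ladder N).induce (stage N d (N + 1))) e := by
    simp [IsFrame, IsFourClique, IsInner, e, P, B, T]
    refine ⟨fun h => ?_, ⟨hN, fun h => ?_⟩, by omega⟩
    · have := LadderVertex.b.inj (congrArg Subtype.val h)
      omega
    · exact LadderVertex.noConfusion (congrArg Subtype.val h)
  have hF' : IsFrame (ladder N) (f ∘ e) := (isFrame_map_iff f).2 hF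
  refine ⟨e, hF, Or.inr (Or.inr fun x hx => ?_)⟩
  rw [← isInner_map_iff f, isInner_iff hN hF'] at hx
  obtain ⟨i, hi, hi1, hiN⟩ := hx
  refine ⟨![P (i + 1) (by omega), B i (by omega)], ?_, ?_, ?_, ?_, ?_⟩
  · rcases hiN.eq_or_lt with rfl | hlt
    · exact Or.inr rfl
    · refine Or.inl ((isInner_map_iff f).1 ((isInner_iff hN hF').2 ⟨i + 1, rfl, ?_, ?_⟩)) <;> omega
  · exact (isCut_map_iff f).1 ((isCut_iff hN hF').2 ⟨i, rfl⟩)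
  · rw [← f.map_adj_iff, hi]
    exact Or.inr rfl
  · rw [← f.map_adj_iff, hi]
    exact le_rfl
  · exact Nat.not_succ_le_self i

/-- Removing an interior vertex from the ladder destroys all full paths. -/
lemma not_hasFullPath_ladder {d : ℕ} (hd : 2 ≤ d) (hdN : d ≤ N + 1) :
    ¬ HasFullPath ((ladder N).induce (stage N d (N + 1))) := by
  have hN : 1 ≤ N := by omega
  let f := SimpleGraph.Embedding.induce (G := ladder N) (stage N d (N + 1))
  rintro ⟨e, hF, h⟩
  have hF' : IsFrame (ladder N) (f ∘ e) := (isFrame_map_iff f).2 hF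
  rcases h with h | h | h
  · exact not_hasCrossing hN hF' (h.map f)
  · exact not_hasTwin hN hF' (h.map f)
  let x : stage N d (N + 1) := ⟨a (d - 1), by omega, by omega⟩
  have hx : f x = a (d - 1) := rfl
  obtain ⟨w, hw, hb, hxw, hbx, hbw⟩ := h ![x] ((isInner_map_iff f).1
    ((isInner_iff hN hF').2 ⟨d - 1, rfl, by omega, by omega⟩))
  rw [← f.map_adj_iff] at hxw hbx hbw
  replace hw : IsInner (ladder N) (f ∘ e) (f (w 0)) ∨ f (w 0) = (f ∘ e) 10 :=
    hw.imp (isInner_map_iff f).2 (congrArg f)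
  obtain ⟨j, hj, -⟩ := eq_a_of_adj hN hF' hw hxw
  obtain ⟨l, hl⟩ := (isCut_iff hN hF').1 ((isCut_map_iff f).2 hb)
  have hjd : j ≠ d := by
    have : f (w 0) ∈ stage N d (N + 1) := (w 0).2
    rw [hj] at this
    exact this.2
  simp [hj, hl, hx] at hxw hbx hbw
  omega

end LadderVertex

/-! ### Cliquewidth -/

namespace CliqueExpr

lemma finite {k : ℕ} {V : Type} {G : SimpleGraph V} {c : V → Fin k} (h : CliqueExpr k V G c) :
    Finite V := by
  induction h with
  | single => infer_instance
  | union => infer_instance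
  | addEdges _ _ _ _ ih => exact ih
  | recolor _ _ _ ih => exact ih

/-- The colors may be renamed injectively. -/
lemma comp {k l : ℕ} {V : Type} {G : SimpleGraph V} {c : V → Fin k} (h : CliqueExpr k V G c)
    {f : Fin k → Fin l} (hf : Function.Injective f) : CliqueExpr l V G (f ∘ c) := by
  induction h with
  | single c => exact single (f c)
  | union _ _ ih ih' =>
    rw [Sum.comp_elim]
    exact union ih ih'
  | @addEdges V G c i j hij _ ih =>
    have := addEdges (f i) (f j) (hf.ne hij) ih
    simpa only [Function.comp_apply, hf.eq_iff] using this
  | @recolor V G c i j _ ih =>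
    have := recolor (f i) (f j) ih
    simp only [Function.comp_apply, hf.eq_iff] at this
    convert this using 2 with v
    exact apply_ite f _ _ _

end CliqueExpr

/-- The subgraph of `G` induced on `S`, with the coloring `c`, is constructible. -/
def ConstructibleOn (k : ℕ) {V : Type} (G : SimpleGraph V) (c : V → Fin k) (S : Set V) : Prop :=
  ∃ (W : Type) (f : W → V), Function.Injective f ∧ Set.range f = S ∧
    CliqueExpr k W (G.comap f) (c ∘ f)

namespace ConstructibleOn

variable {k : ℕ} {V : Type} {G G' : SimpleGraph V} {c c' : V → Fin k} {S T : Set V}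

lemma finite (h : ConstructibleOn k G c S) : S.Finite := by
  obtain ⟨W, f, -, rfl, h⟩ := h
  have := h.finite
  exact Set.finite_range f

lemma cliquewidthLE_induce {l : ℕ} (hkl : k ≤ l) (h : ConstructibleOn k G c S) :
    CliquewidthLE (G.induce S) l := by
  obtain ⟨W, f, hf, rfl, h⟩ := h
  refine ⟨W, _, _, h.comp (Fin.castLE_injective hkl), ⟨RelIso.symm ⟨Equiv.ofInjective f hf, ?_⟩⟩⟩
  simp

lemma congr (h : ConstructibleOn k G c S) (hc : ∀ x ∈ S, c' x = c x)
    (hG : ∀ x ∈ S, ∀ y ∈ S, (G'.Adj x y ↔ G.Adj x y)) : ConstructibleOn k G' c' S := by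
  obtain ⟨W, f, hf, rfl, h⟩ := h
  refine ⟨W, f, hf, rfl, ?_⟩
  convert h using 1
  · ext x y
    exact hG _ ⟨x, rfl⟩ _ ⟨y, rfl⟩
  · ext x
    rw [Function.comp_apply, hc _ ⟨x, rfl⟩, Function.comp_apply]

lemma singleton (G : SimpleGraph V) (c : V → Fin k) (v : V) : ConstructibleOn k G c {v} := by
  refine ⟨PUnit, fun _ => v, fun _ _ _ => rfl, Set.range_const, ?_⟩
  convert CliqueExpr.single (c v) using 1
  · ext x y
    simp
  · rfl

lemma union (hS : ConstructibleOn k G c S) (hT : ConstructibleOn k G c T) (hST : Disjoint S T)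
    (h : ∀ x ∈ S, ∀ y ∈ T, ¬ G.Adj x y) : ConstructibleOn k G c (S ∪ T) := by
  obtain ⟨W, f, hf, rfl, hS⟩ := hS
  obtain ⟨W', f', hf', rfl, hT⟩ := hT
  refine ⟨W ⊕ W', Sum.elim f f', ?_, Set.Sum.elim_range f f', ?_⟩
  · refine hf.sumElim hf' fun x y hxy => ?_
    exact Set.disjoint_left.1 hST ⟨x, rfl⟩ (hxy ▸ ⟨y, rfl⟩)
  · convert CliqueExpr.union hS hT using 1
    · ext (x | x) (y | y)
      · simp
      · simpa using h _ ⟨x, rfl⟩ _ ⟨y, rfl⟩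
      · simpa using fun h' => h _ ⟨y, rfl⟩ _ ⟨x, rfl⟩ h'.symm
      · simp
    · exact Sum.comp_elim c f f'

lemma addEdges (h : ConstructibleOn k G c S) {i j : Fin k} (hij : i ≠ j) :
    ConstructibleOn k (G ⊔ SimpleGraph.fromRel fun x y => c x = i ∧ c y = j) c S := by
  obtain ⟨W, f, hf, rfl, h⟩ := h
  refine ⟨W, f, hf, rfl, ?_⟩
  convert CliqueExpr.addEdges i j hij h using 1
  ext x y
  simp [hf.eq_iff]

lemma recolor (h : ConstructibleOn k G c S) (i j : Fin k)
    (hc : ∀ x ∈ S, c' x = if c x = i then j else c x) : ConstructibleOn k G c' S := by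
  obtain ⟨W, f, hf, rfl, h⟩ := h
  refine congr ?_ hc fun _ _ _ _ => Iff.rfl
  exact ⟨W, f, hf, rfl, h.recolor i j⟩

/-- Joining the vertices of color `j` in `T` to the vertices of color `i₁` or `i₂` in `S`. -/
lemma join (hS : ConstructibleOn k G c S) (hT : ConstructibleOn k G c T) (hST : Disjoint S T)
    {i₁ i₂ j : Fin k} (h₁ : i₁ ≠ j) (h₂ : i₂ ≠ j) (hcS : ∀ x ∈ S, c x ≠ j)
    (hcT : ∀ y ∈ T, c y ≠ i₁ ∧ c y ≠ i₂)
    (h : ∀ x ∈ S, ∀ y ∈ T, (G.Adj x y ↔ (c x = i₁ ∨ c x = i₂) ∧ c y = j)) :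
    ConstructibleOn k G c (S ∪ T) := by
  let G₀ : SimpleGraph V :=
    { Adj := fun x y => G.Adj x y ∧ ¬ (x ∈ S ∧ y ∈ T) ∧ ¬ (x ∈ T ∧ y ∈ S)
      symm := ⟨fun x y h => ⟨h.1.symm, fun h' => h.2.2 h'.symm, fun h' => h.2.1 h'.symm⟩⟩
      loopless := ⟨fun x h => G.irrefl h.1⟩ }
  have hd : ∀ x, x ∈ S → x ∉ T := fun x hx => Set.disjoint_left.1 hST hx
  have h₀ : ConstructibleOn k G₀ c (S ∪ T) := by
    refine union (hS.congr (fun _ _ => rfl) ?_) (hT.congr (fun _ _ => rfl) ?_) hST ?_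
    · exact fun x hx y hy => ⟨And.left, fun h => ⟨h, fun h' => hd y hy h'.2, fun h' => hd x hx h'.1⟩⟩
    · exact fun x hx y hy => ⟨And.left, fun h => ⟨h, fun h' => hd x h'.1 hx, fun h' => hd y h'.2 hy⟩⟩
    · exact fun x hx y hy h' => h'.2.1 ⟨hx, hy⟩
  refine ((h₀.addEdges h₁).addEdges h₂).congr (fun _ _ => rfl) fun x hx y hy => ?_
  have hxy := G.ne_of_adj (a := x) (b := y)
  simp only [SimpleGraph.sup_adj, SimpleGraph.fromRel_adj, G₀]
  rcases hx with hx | hx <;> rcases hy with hy | hy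
  · grind
  · have := h x hx y hy
    grind
  · have := h y hy x hx
    rw [G.adj_comm] at this
    grind
  · grind

end ConstructibleOn

namespace LadderVertex

variable {N : ℕ}

/-- The colors of the completed part of the ladder: the vertex `a m` may still get
neighbours on the path, and the other path vertices only among the cuts. -/
def stageColor (m : ℕ) : LadderVertex → Fin 4
  | a i => if i = m then 2 else 1
  | _ => 0

/-- The vertices added to the ladder together with the cut `b m`. -/
def cutPart (N m : ℕ) : Set LadderVertex
  | a _ => False
  | b j => j = m
  | g s _ => root N s = m

/-- The coloring used while the cut `b m` is being added. -/
def cutColor (m : ℕ) : LadderVertex → Fin 4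
  | a i => if i = m then 2 else 1
  | b j => if j = m then 3 else 0
  | g _ _ => 0

/-- The coloring used while the path vertex `a (m + 1)` is being added. -/
def pathColor (m : ℕ) : LadderVertex → Fin 4
  | a i => if i = m + 1 then 3 else if i = m then 2 else 1
  | _ => 0

@[simp] lemma a_mem_cutPart {m i : ℕ} : a i ∉ cutPart N m := id
@[simp] lemma b_mem_cutPart {m j : ℕ} : b j ∈ cutPart N m ↔ j = m := Iff.rfl
@[simp] lemma g_mem_cutPart {m : ℕ} {s k} : g s k ∈ cutPart N m ↔ root N s = m := Iff.rfl

lemma constructibleOn_cutPart (hN : 1 ≤ N) (m : ℕ) :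
    ConstructibleOn 4 (ladder N) (cutColor m) (cutPart N m) := by
  by_cases hm : ∃ s, root N s = m
  · obtain ⟨s, rfl⟩ := hm
    have hs : ∀ t, root N t = root N s ↔ t = s := by
      intro t
      cases s <;> cases t <;> simp <;> omega
    let c₁ : LadderVertex → Fin 4 := fun x => if x = g s 1 then 3 else 0
    have h₁ : ConstructibleOn 4 (ladder N) c₁ ({g s 0} ∪ {g s 1}) := by
      refine ConstructibleOn.join (i₁ := 0) (i₂ := 0) (j := 3)
        (ConstructibleOn.singleton _ _ _) (ConstructibleOn.singleton _ _ _) ?_ ?_ ?_ ?_ ?_ ?_ <;>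
        simp [c₁]
    let c₂ : LadderVertex → Fin 4 := fun x => if x = g s 2 then 3 else 0
    have h₂ : ConstructibleOn 4 (ladder N) c₂ ({g s 0} ∪ {g s 1} ∪ {g s 2}) := by
      refine ConstructibleOn.join (i₁ := 0) (i₂ := 0) (j := 3)
        (h₁.recolor 3 0 ?_) (ConstructibleOn.singleton _ _ _) ?_ ?_ ?_ ?_ ?_ ?_ <;>
        simp [c₁, c₂]
    have h₃ : ConstructibleOn 4 (ladder N) (cutColor (root N s))
        ({g s 0} ∪ {g s 1} ∪ {g s 2} ∪ {b (root N s)}) := by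
      refine ConstructibleOn.join (i₁ := 0) (i₂ := 0) (j := 3)
        (h₂.recolor 3 0 ?_) (ConstructibleOn.singleton _ _ _) ?_ ?_ ?_ ?_ ?_ ?_ <;>
        simp [c₂, cutColor]
    convert h₃ using 1
    ext (i | j | ⟨t, k⟩)
    · simp
    · simp
    · fin_cases k <;> simp [hs]
  · convert ConstructibleOn.singleton (ladder N) (cutColor m) (b m) using 1
    ext (i | j | ⟨t, k⟩)
    · simp
    · simp
    · simpa using fun h => hm ⟨t, h⟩

lemma constructibleOn_stage (hN : 1 ≤ N) {d : ℕ} (hd : 1 ≤ d) (m : ℕ) :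
    ConstructibleOn 4 (ladder N) (stageColor m) (stage N d m) := by
  induction m with
  | zero =>
    convert ConstructibleOn.singleton (ladder N) (stageColor 0) (a 0) using 1
    ext (i | j | ⟨t, k⟩) <;> simp
    omega
  | succ m ih =>
    have hcut : ConstructibleOn 4 (ladder N) (stageColor m) (stage N d m ∪ cutPart N m) := by
      refine ConstructibleOn.recolor (c := cutColor m) ?_ 3 0 ?_
      · refine ConstructibleOn.join (i₁ := 1) (i₂ := 2) (j := 3)
          (ih.congr ?_ fun _ _ _ _ => Iff.rfl) (constructibleOn_cutPart hN m) ?_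
          (by decide) (by decide) ?_ ?_ ?_
        · rintro (i | j | ⟨t, k⟩) <;> simp [stageColor, cutColor]
          omega
        · rw [Set.disjoint_left]
          rintro (i | j | ⟨t, k⟩) <;> simp <;> omega
        · rintro (i | j | ⟨t, k⟩) <;> simp [cutColor] <;> grind
        · rintro (i | j | ⟨t, k⟩) <;> simp [cutColor]
          grind
        · rintro (i | j | ⟨t, k⟩) hx (i' | j' | ⟨t', k'⟩) hy <;> simp [cutColor] at * <;> grind
      · rintro (i | j | ⟨t, k⟩) <;> simp [stageColor, cutColor]
        grind
    by_cases hmd : m + 1 = d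
    · have : stage N d (m + 1) = stage N d m ∪ cutPart N m := by
        ext (i | j | ⟨t, k⟩) <;> simp <;> omega
      rw [this]
      refine hcut.recolor 2 1 ?_
      rintro (i | j | ⟨t, k⟩) <;> simp [stageColor]
      grind
    · have : stage N d (m + 1) = stage N d m ∪ cutPart N m ∪ {a (m + 1)} := by
        ext (i | j | ⟨t, k⟩) <;> simp <;> omega
      rw [this]
      let c : LadderVertex → Fin 4 := fun x => if pathColor m x = 2 then 1 else pathColor m x
      refine ConstructibleOn.recolor (c := c) ?_ 3 2 ?_
      · refine ConstructibleOn.recolor (c := pathColor m) ?_ 2 1 fun _ _ => rfl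
        refine ConstructibleOn.join (i₁ := 2) (i₂ := 2) (j := 3)
          (hcut.congr ?_ fun _ _ _ _ => Iff.rfl) (ConstructibleOn.singleton _ _ _) ?_
          (by decide) (by decide) ?_ ?_ ?_
        · rintro (i | j | ⟨t, k⟩) <;> simp [stageColor, pathColor]
          grind
        · simp
        · rintro (i | j | ⟨t, k⟩) <;> simp [pathColor]
          grind
        · simp [pathColor]
        · rintro (i | j | ⟨t, k⟩) hx _ rfl <;> simp [pathColor] at * <;> grind
      · rintro (i | j | ⟨t, k⟩) <;> simp [stageColor, pathColor, c]
        grind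

end LadderVertex

/-- For every `k ≥ 4`, extension preservation fails on the class of all finite simple graphs of
cliquewidth at most `k`: some first-order sentence is preserved by embeddings over this class
but is not equivalent over it to any existential sentence. -/
theorem stmt_7 (k : ℕ) (hk : 4 ≤ k) :
    ∃ φ : Language.graph.Sentence,
      (∀ (V W : Type) [Fintype V] [Fintype W] (G : SimpleGraph V) (H : SimpleGraph W),
        CliquewidthLE G k → CliquewidthLE H k → (G ↪g H) → GSat G φ → GSat H φ) ∧
      ¬ ∃ ψ : Language.graph.Sentence, IsExistentialSentence ψ ∧
          ∀ (V : Type) [Fintype V] (G : SimpleGraph V),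
            CliquewidthLE G k → (GSat G φ ↔ GSat G ψ) := by
  obtain ⟨φ, hφ⟩ := exists_sentence_hasFullPath
  refine ⟨φ, fun V W _ _ G H _ _ f h => (hφ W H).2 (((hφ V G).1 h).map f), ?_⟩
  rintro ⟨ψ, hψ, hφψ⟩
  obtain ⟨n, hn⟩ := hψ.exists_witnesses
  let Γ (d : ℕ) := (LadderVertex.ladder (n + 2)).induce (LadderVertex.stage (n + 2) d (n + 3))
  have hΓ (d : ℕ) (hd : 1 ≤ d) : GSat (Γ d) φ ↔ GSat (Γ d) ψ := by
    have h := LadderVertex.constructibleOn_stage (N := n + 2) (by omega) hd (n + 3)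
    have := h.finite.fintype
    exact hφψ _ _ (h.cliquewidthLE_induce hk)
  obtain ⟨x, hx⟩ := hn _ _ ((hΓ (n + 4) (by omega)).1
    ((hφ _ _).2 (LadderVertex.hasFullPath_ladder (by omega) le_rfl)))
  obtain ⟨d, hd, hdx⟩ : ∃ d ∈ Finset.Icc 2 (n + 2), ∀ i, (x i).1 ≠ LadderVertex.a d := by
    by_contra! hcon
    have : Nonempty (Fin n) := ⟨(hcon 2 (by simp)).choose⟩
    choose! i hi using hcon
    have hle := Finset.card_le_card_of_injOn (s := Finset.Icc 2 (n + 2)) (t := Finset.univ) i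
      (fun _ _ => Finset.mem_univ _) fun d hd d' hd' h =>
        LadderVertex.a.inj ((hi d hd).symm.trans ((congrArg (fun j => (x j).1) h).trans (hi d' hd')))
    simp at hle
  rw [Finset.mem_Icc] at hd
  have hsub : LadderVertex.stage (n + 2) d (n + 3) ⊆ LadderVertex.stage (n + 2) (n + 4) (n + 3) := by
    rintro (i | j | ⟨s, k⟩) <;> simp
    omega
  refine LadderVertex.not_hasFullPath_ladder (N := n + 2) hd.1 (by omega) ((hφ _ _).1
    ((hΓ d (by omega)).2 (hx _ _ (SimpleGraph.induceHomOfLE _ hsub) fun i => ?_)))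
  have hmem : (x i).1 ∈ LadderVertex.stage (n + 2) d (n + 3) := by
    have h := (x i).2
    have h' := hdx i
    generalize (x i).1 = v at h h'
    rcases v with i | j | ⟨s, k⟩
    · simp at h h' ⊢
      omega
    · exact h
    · exact h
  exact ⟨⟨_, hmem⟩, rfl⟩
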